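/- Let Q be the 3-dimensional real Leibniz algebra with bracket determined by [f,f]=e and [g,g]=e (all other brackets of basis vectors zero). A linear map N : Q → Q is a Nijenhuis operator on Q if and only if its matrix (rows = coordinates of N(e), N(f), N(g) in the basis {e,f,g}) has the form with rows (k₁,0,0), (ℓ₁,k₁,0), (p₁,0,k₁) for some real parameters k₁, ℓ₁, p₁. -/

import Mathlib

/-- Bracket of the 3-dim real Leibniz algebra with [f,f]=e, [g,g]=e
(basis e,f,g ↔ indices 0,1,2). -/
noncomputable def br (x y : Fin 3 → ℝ) : Fin 3 → ℝ :=
  ![x 1 * y 1 + x 2 * y 2, 0, 0]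

lemma map_eq_smul_add (N : (Fin 3 → ℝ) →ₗ[ℝ] (Fin 3 → ℝ)) (x : Fin 3 → ℝ) :
    N x = x 0 • N ![1,0,0] + x 1 • N ![0,1,0] + x 2 • N ![0,0,1] := by
  rw [← map_smul, ← map_smul, ← map_smul, ← map_add, ← map_add]
  congr 1
  ext i
  fin_cases i <;> simp

lemma br_eq_smul (x y : Fin 3 → ℝ) :
    br x y = (x 1 * y 1 + x 2 * y 2) • (![1,0,0] : Fin 3 → ℝ) := by
  ext i
  fin_cases i <;> simp [br]

theorem nijenhuis_classification_thm2_5 (N : (Fin 3 → ℝ) →ₗ[ℝ] (Fin 3 → ℝ)) :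
    (∀ x y, br (N x) (N y) + N (N (br x y)) = N (br (N x) y) + N (br x (N y)))
    ↔
    (∃ k₁ ℓ₁ p₁ : ℝ,
      N ![1,0,0] = ![k₁,0,0] ∧ N ![0,1,0] = ![ℓ₁,k₁,0] ∧ N ![0,0,1] = ![p₁,0,k₁]) := by
  constructor
  · intro h
    simp only [br_eq_smul, map_smul] at h
    have hee := congrFun (h ![1,0,0] ![1,0,0]) 0
    simp at hee
    have hk₂ : N ![1,0,0] 1 = 0 := by nlinarith [mul_self_nonneg (N ![1,0,0] 1), mul_self_nonneg (N ![1,0,0] 2)]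
    have hk₃ : N ![1,0,0] 2 = 0 := by nlinarith [mul_self_nonneg (N ![1,0,0] 1), mul_self_nonneg (N ![1,0,0] 2)]
    have he : N ![1,0,0] = N ![1,0,0] 0 • (![1,0,0] : Fin 3 → ℝ) := by
      ext i
      fin_cases i <;> simp [hk₂, hk₃]
    have hNe : N (N ![1,0,0]) 0 = N ![1,0,0] 0 * N ![1,0,0] 0 := by
      conv_lhs => rw [he, map_smul]
      simp
    have hff := congrFun (h ![0,1,0] ![0,1,0]) 0
    have hgg := congrFun (h ![0,0,1] ![0,0,1]) 0
    simp [hNe] at hff hgg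
    set k := N ![1,0,0] 0
    have hf₁ : N ![0,1,0] 1 - k = 0 := by
      nlinarith [sq_nonneg (N ![0,1,0] 1 - k), sq_nonneg (N ![0,1,0] 2)]
    have hf₂ : N ![0,1,0] 2 = 0 := by
      nlinarith [sq_nonneg (N ![0,1,0] 1 - k), sq_nonneg (N ![0,1,0] 2)]
    have hg₁ : N ![0,0,1] 1 = 0 := by
      nlinarith [sq_nonneg (N ![0,0,1] 2 - k), sq_nonneg (N ![0,0,1] 1)]
    have hg₂ : N ![0,0,1] 2 - k = 0 := by
      nlinarith [sq_nonneg (N ![0,0,1] 2 - k), sq_nonneg (N ![0,0,1] 1)]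
    refine ⟨k, N ![0,1,0] 0, N ![0,0,1] 0, ?_, ?_, ?_⟩
    · rw [he]
      simp
    · ext i
      fin_cases i <;> simp [hf₂, sub_eq_zero.mp hf₁]
    · ext i
      fin_cases i <;> simp [hg₁, sub_eq_zero.mp hg₂]
  · rintro ⟨k, l, p, he, hf, hg⟩ x y
    have hN (z : Fin 3 → ℝ) : N z = ![z 0 * k + z 1 * l + z 2 * p, z 1 * k, z 2 * k] := by
      rw [map_eq_smul_add, he, hf, hg]
      ext i
      fin_cases i <;> simp
    ext i
    fin_cases i <;> simp [hN, br]
    ring
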